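/- For positive definite matrices A, B, 1 ≤ p ≤ 2, and t ∈ [0,1], the function t ↦ trace((A - μ_p(A,B,t))²), with μ_p(A,B,t) = (t·A^p + (1-t)·B^p)^(1/p), is monotonically decreasing on [0,1]. -/

import Mathlib

open Matrix MeasureTheory
open scoped ComplexOrder

/-- Apply a real function to a Hermitian matrix via the spectral decomposition. -/
noncomputable def matFun {n : ℕ} (A : Matrix (Fin n) (Fin n) ℂ) (hA : A.IsHermitian)
    (g : ℝ → ℝ) : Matrix (Fin n) (Fin n) ℂ :=
  (hA.eigenvectorUnitary : Matrix (Fin n) (Fin n) ℂ) *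
    Matrix.diagonal (fun i => (g (hA.eigenvalues i) : ℂ)) *
    star (hA.eigenvectorUnitary : Matrix (Fin n) (Fin n) ℂ)

/-- Real power of a Hermitian matrix via the spectral decomposition. -/
noncomputable def mpow {n : ℕ} (A : Matrix (Fin n) (Fin n) ℂ) (hA : A.IsHermitian)
    (p : ℝ) : Matrix (Fin n) (Fin n) ℂ :=
  matFun A hA (fun x => x ^ p)

/-- Hilbert-Schmidt (Frobenius) norm of a matrix. -/
noncomputable def frob {n : ℕ} (X : Matrix (Fin n) (Fin n) ℂ) : ℝ :=
  Real.sqrt (Matrix.trace (star X * X)).re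

open scoped MatrixOrder Matrix.Norms.L2Operator

section

variable {n : ℕ}

theorem matFun_eq_cfc (A : Matrix (Fin n) (Fin n) ℂ) (hA : A.IsHermitian) (g : ℝ → ℝ) :
    matFun A hA g = cfc g A := by
  rw [hA.cfc_eq, Matrix.IsHermitian.cfc, Unitary.conjStarAlgAut_apply]
  rfl

theorem mpow_eq_rpow (A : Matrix (Fin n) (Fin n) ℂ) (hA : A.PosSemidef) (p : ℝ) :
    mpow A hA.1 p = A ^ p := by
  rw [mpow, matFun_eq_cfc, CFC.rpow_eq_cfc_real hA.nonneg]

/-- Jensen's inequality for the diagonal entries of a positive semidefinite matrix in an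
orthonormal basis. -/
theorem map_diag_le_diag_cfc {X U : Matrix (Fin n) (Fin n) ℂ} (hX : X.PosSemidef)
    (hU : U ∈ Matrix.unitaryGroup (Fin n) ℂ) {f : ℝ → ℝ} (hf : ConvexOn ℝ (Set.Ici 0) f)
    (i : Fin n) :
    0 ≤ ((star U * X * U) i i).re ∧
      f ((star U * X * U) i i).re ≤ ((star U * cfc f X * U) i i).re := by
  set V : Matrix (Fin n) (Fin n) ℂ := hX.1.eigenvectorUnitary.val with hV
  set W := star U * V with hW
  have hWW : W * star W = 1 := by
    have h1 : V * star V = 1 := Unitary.mul_star_self_of_mem hX.1.eigenvectorUnitary.2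
    have h2 : star U * U = 1 := Unitary.star_mul_self_of_mem hU
    rw [hW, star_mul, star_star, mul_assoc, ← mul_assoc V, h1, one_mul, h2]
  have key : ∀ g : ℝ → ℝ, ((star U * cfc g X * U) i i).re =
      ∑ j, Complex.normSq (W i j) • g (hX.1.eigenvalues j) := by
    intro g
    have : star U * cfc g X * U =
        W * Matrix.diagonal (fun j => (g (hX.1.eigenvalues j) : ℂ)) * star W := by
      rw [← matFun_eq_cfc X hX.1, matFun, hW, star_mul, star_star]
      simp only [mul_assoc, ← hV]
    rw [this, Matrix.mul_apply, Complex.re_sum]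
    refine Finset.sum_congr rfl fun j _ => ?_
    rw [Matrix.mul_diagonal, Matrix.star_apply]
    simp [Complex.normSq_apply]
    ring
  have hid : cfc (fun x : ℝ => x) X = X := cfc_id' ℝ X hX.1
  have hsum : ∑ j, Complex.normSq (W i j) = 1 := by
    have h := congrArg Complex.re (congrFun (congrFun hWW i) i)
    rw [Matrix.mul_apply, Complex.re_sum] at h
    simpa [Complex.normSq_apply] using h
  have h0 := key fun x => x
  rw [hid] at h0
  rw [h0, key f]
  exact ⟨Finset.sum_nonneg fun j _ => smul_nonneg (Complex.normSq_nonneg _)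
      (hX.eigenvalues_nonneg j),
    hf.map_sum_le (fun j _ => Complex.normSq_nonneg _) hsum fun j _ => hX.eigenvalues_nonneg j⟩

theorem trace_star_mul_mul_of_mem_unitary {U : Matrix (Fin n) (Fin n) ℂ}
    (hU : U ∈ Matrix.unitaryGroup (Fin n) ℂ) (Z : Matrix (Fin n) (Fin n) ℂ) :
    (star U * Z * U).trace = Z.trace := by
  rw [Matrix.trace_mul_comm, ← mul_assoc, Unitary.mul_star_self_of_mem hU, one_mul]

/-- The trace function of a convex function is convex on positive semidefinite matrices. -/
theorem convexOn_re_trace_cfc {f : ℝ → ℝ} (hf : ConvexOn ℝ (Set.Ici 0) f) :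
    ConvexOn ℝ (Set.Ici (0 : Matrix (Fin n) (Fin n) ℂ)) fun X => (cfc f X).trace.re := by
  refine ⟨convex_Ici 0, fun X hX Y hY a b ha hb hab => ?_⟩
  have hXp : X.PosSemidef := Matrix.nonneg_iff_posSemidef.1 hX
  have hYp : Y.PosSemidef := Matrix.nonneg_iff_posSemidef.1 hY
  set M := a • X + b • Y with hM
  have hMp : M.PosSemidef :=
    Matrix.nonneg_iff_posSemidef.1 (convex_Ici (0 : Matrix (Fin n) (Fin n) ℂ) hX hY ha hb hab)
  set U : Matrix (Fin n) (Fin n) ℂ := hMp.1.eigenvectorUnitary.val with hUdef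
  have hU : U ∈ Matrix.unitaryGroup (Fin n) ℂ := hMp.1.eigenvectorUnitary.2
  have hUU : star U * U = 1 := Unitary.star_mul_self_of_mem hU
  have hdiag : ∀ g : ℝ → ℝ, star U * cfc g M * U =
      Matrix.diagonal (fun j => (g (hMp.1.eigenvalues j) : ℂ)) := by
    intro g
    rw [← matFun_eq_cfc M hMp.1, matFun, ← hUdef, mul_assoc, mul_assoc, hUU, mul_one, ← mul_assoc,
      hUU, one_mul]
  have hMU := hdiag fun x => x
  have hid : cfc (fun x : ℝ => x) M = M := cfc_id' ℝ M hMp.1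
  rw [hid] at hMU
  simp only [smul_eq_mul]
  rw [← trace_star_mul_mul_of_mem_unitary hU, ← trace_star_mul_mul_of_mem_unitary hU (cfc f X),
    ← trace_star_mul_mul_of_mem_unitary hU (cfc f Y)]
  simp only [Matrix.trace, Matrix.diag_apply, Complex.re_sum, Finset.mul_sum,
    ← Finset.sum_add_distrib]
  refine Finset.sum_le_sum fun i _ => ?_
  obtain ⟨hx0, hx⟩ := map_diag_le_diag_cfc hXp hU hf i
  obtain ⟨hy0, hy⟩ := map_diag_le_diag_cfc hYp hU hf i
  have hev : hMp.1.eigenvalues i =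
      a * ((star U * X * U) i i).re + b * ((star U * Y * U) i i).re := by
    have h := congrArg Complex.re (congrFun (congrFun hMU i) i)
    have hsplit : star U * M * U = a • (star U * X * U) + b • (star U * Y * U) := by
      rw [hM, mul_add, add_mul, mul_smul_comm, mul_smul_comm, smul_mul_assoc, smul_mul_assoc]
    rw [hsplit] at h
    simpa using h.symm
  rw [hdiag f, Matrix.diagonal_apply_eq, Complex.ofReal_re, hev]
  calc _ ≤ a * f ((star U * X * U) i i).re + b * f ((star U * Y * U) i i).re := by
        simpa using hf.2 hx0 hy0 ha hb hab
    _ ≤ _ := by gcongr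

theorem re_trace_mul_le_re_trace_mul {A X Y : Matrix (Fin n) (Fin n) ℂ} (hA : A.PosSemidef)
    (hXY : X ≤ Y) : (A * X).trace.re ≤ (A * Y).trace.re := by
  have hS : (CFC.sqrt A).IsHermitian := (Matrix.nonneg_iff_posSemidef.1 (CFC.sqrt_nonneg A)).1
  have h := (Matrix.le_iff.1 hXY).mul_mul_conjTranspose_same (CFC.sqrt A)
  have h2 := (Complex.le_def.1 h.trace_nonneg).1
  rw [hS.eq, Matrix.trace_mul_comm, ← mul_assoc, CFC.sqrt_mul_sqrt_self A hA.nonneg, mul_sub,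
    Matrix.trace_sub, Complex.sub_re, Complex.zero_re] at h2
  linarith

theorem convexOn_re_trace_sub_rpow_mul_self {A : Matrix (Fin n) (Fin n) ℂ} (hA : A.PosSemidef)
    {q : ℝ} (hq : q ∈ Set.Icc (1 / 2 : ℝ) 1) :
    ConvexOn ℝ (Set.Ici (0 : Matrix (Fin n) (Fin n) ℂ))
      fun X => ((A - X ^ q) * (A - X ^ q)).trace.re := by
  have hexp : ∀ X : Matrix (Fin n) (Fin n) ℂ, ((A - X ^ q) * (A - X ^ q)).trace.re =
      (A * A).trace.re - 2 * (A * X ^ q).trace.re + (X ^ q * X ^ q).trace.re := by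
    intro X
    rw [sub_mul, mul_sub, mul_sub]
    simp only [Matrix.trace_sub, Complex.sub_re]
    rw [Matrix.trace_mul_comm (X ^ q) A]
    ring
  have hsq : ∀ X ∈ Set.Ici (0 : Matrix (Fin n) (Fin n) ℂ),
      X ^ q * X ^ q = cfc (fun x : ℝ => x ^ q * x ^ q) X := by
    intro X hX
    have hq0 : (0 : ℝ) ≤ q := by linarith [hq.1]
    rw [CFC.rpow_eq_cfc_real hX, cfc_mul _ _ X]
  have hf : ConvexOn ℝ (Set.Ici 0) fun x : ℝ => x ^ q * x ^ q := by
    refine (convexOn_rpow (p := q + q) (by linarith [hq.1])).congr fun x hx => ?_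
    exact Real.rpow_add_of_nonneg hx (by linarith [hq.1]) (by linarith [hq.1])
  refine ⟨convex_Ici 0, fun X hX Y hY a b ha hb hab => ?_⟩
  have h1 := (convexOn_re_trace_cfc (n := n) hf).2 hX hY ha hb hab
  have h2 := re_trace_mul_le_re_trace_mul hA
    ((CFC.concaveOn_rpow (A := Matrix (Fin n) (Fin n) ℂ) (p := q)
      ⟨by linarith [hq.1], hq.2⟩).2 hX hY ha hb hab)
  simp only [← hsq _ hX, ← hsq _ hY, ← hsq _ (convex_Ici _ hX hY ha hb hab), smul_eq_mul] at h1
  simp only [mul_add, mul_smul_comm, Matrix.trace_add, Matrix.trace_smul, Complex.add_re,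
    Complex.smul_re, smul_eq_mul] at h2
  simp only [hexp, smul_eq_mul]
  have h3 : (A * A).trace.re = a * (A * A).trace.re + b * (A * A).trace.re := by
    rw [← add_mul, hab, one_mul]
  linarith

theorem re_trace_sub_rpow_mul_self_nonneg {A : Matrix (Fin n) (Fin n) ℂ} (hA : A.IsHermitian)
    (X : Matrix (Fin n) (Fin n) ℂ) (q : ℝ) : 0 ≤ ((A - X ^ q) * (A - X ^ q)).trace.re := by
  have hX : (X ^ q).IsHermitian :=
    (Matrix.nonneg_iff_posSemidef.1 (CFC.rpow_nonneg (a := X) (y := q))).1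
  have h := (Matrix.posSemidef_conjTranspose_mul_self (A - X ^ q)).trace_nonneg
  rw [(hA.sub hX).eq] at h
  exact (Complex.le_def.1 h).1

end

theorem stmt6 {n : ℕ} (A B : Matrix (Fin n) (Fin n) ℂ)
    (hA : A.PosDef) (hB : B.PosDef) (p : ℝ) (hp : p ∈ Set.Icc (1:ℝ) 2)
    (t₁ t₂ : ℝ) (ht₁ : t₁ ∈ Set.Icc (0:ℝ) 1) (ht₂ : t₂ ∈ Set.Icc (0:ℝ) 1)
    (h12 : t₁ ≤ t₂)
    (hM₁ : (t₁ • mpow A hA.1 p + (1 - t₁) • mpow B hB.1 p).IsHermitian)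
    (hM₂ : (t₂ • mpow A hA.1 p + (1 - t₂) • mpow B hB.1 p).IsHermitian) :
    (Matrix.trace ((A - mpow _ hM₂ (1/p)) * (A - mpow _ hM₂ (1/p)))).re ≤
      (Matrix.trace ((A - mpow _ hM₁ (1/p)) * (A - mpow _ hM₁ (1/p)))).re := by
  have hp0 : p ≠ 0 := by linarith [hp.1]
  have hq : 1 / p ∈ Set.Icc (1 / 2 : ℝ) 1 := by
    have hpos : 0 < p := by linarith [hp.1]
    exact ⟨one_div_le_one_div_of_le hpos hp.2, (div_le_one hpos).2 hp.1⟩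
  rcases eq_or_lt_of_le ht₁.2 with h1 | h1
  · obtain rfl : t₁ = t₂ := le_antisymm h12 (h1 ▸ ht₂.2)
    exact le_rfl
  have hX : 0 ≤ mpow A hA.1 p := by
    rw [mpow_eq_rpow A hA.posSemidef]; exact CFC.rpow_nonneg
  have hY : 0 ≤ mpow B hB.1 p := by
    rw [mpow_eq_rpow B hB.posSemidef]; exact CFC.rpow_nonneg
  have hXA : mpow A hA.1 p ^ (1 / p) = A := by
    rw [mpow_eq_rpow A hA.posSemidef, CFC.rpow_rpow A p (1 / p) hp0 hA.isStrictlyPositive,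
      mul_one_div_cancel hp0, CFC.rpow_one A]
  set X := mpow A hA.1 p
  set Y := mpow B hB.1 p
  have hC : ∀ t ∈ Set.Icc (0 : ℝ) 1, 0 ≤ t • X + (1 - t) • Y := fun t ht =>
    convex_Ici (0 : Matrix (Fin n) (Fin n) ℂ) hX hY ht.1 (sub_nonneg.2 ht.2) (by ring)
  rw [mpow_eq_rpow _ (Matrix.nonneg_iff_posSemidef.1 (hC t₁ ht₁)),
    mpow_eq_rpow _ (Matrix.nonneg_iff_posSemidef.1 (hC t₂ ht₂))]
  have hd : 0 < 1 - t₁ := sub_pos.2 h1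
  set s := (t₂ - t₁) / (1 - t₁)
  have hsd : s * (1 - t₁) = t₂ - t₁ := div_mul_cancel₀ _ hd.ne'
  have hs0 : 0 ≤ s := div_nonneg (sub_nonneg.2 h12) hd.le
  have hs1 : s ≤ 1 := (div_le_one hd).2 (by linarith [ht₂.2])
  have hcomb : t₂ • X + (1 - t₂) • Y = (1 - s) • (t₁ • X + (1 - t₁) • Y) + s • X := by
    have e1 : t₂ = (1 - s) * t₁ + s := by linarith
    have e2 : 1 - t₂ = (1 - s) * (1 - t₁) := by linarith
    rw [e2, smul_add, smul_smul, smul_smul, add_right_comm, ← add_smul, ← e1]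
  have h := (convexOn_re_trace_sub_rpow_mul_self hA.posSemidef hq).2 (hC t₁ ht₁) hX
    (sub_nonneg.2 hs1) hs0 (by ring)
  have hnn := re_trace_sub_rpow_mul_self_nonneg hA.1 (t₁ • X + (1 - t₁) • Y) (1 / p)
  rw [← hcomb] at h
  simp only [hXA, sub_self, mul_zero, Matrix.trace_zero, Complex.zero_re, smul_eq_mul,
    add_zero] at h
  exact h.trans (mul_le_of_le_one_left hnn (by linarith))
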